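/- Let a ∈ C²([0,ℓ];ℝ) with a > 0 on [0,ℓ] and let M > 0. Then there exists a constant C > 0, depending only on ℓ, a and M, such that for all p, q ∈ C¹([0,ℓ];ℝ) with ‖p‖_{C[0,ℓ]} ≤ M and ‖q‖_{C[0,ℓ]} ≤ M, the solution K of the Goursat problem associated with (a,p,q) satisfies, for every x ∈ (0,ℓ], the a priori bound sup_{(x',y) ∈ closure Ω_x} |K(x',y)| ≤ C x ‖p − q‖_{C[0,x]}, where ‖f‖_{C[0,x]} = sup_{0≤s≤x}|f(s)|. -/

import Mathlib

open Set MeasureTheory intervalIntegral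

noncomputable section

/-- `K` solves the Goursat problem associated with `(a, p, q)` on the closed
triangle `{0 ≤ y ≤ x ≤ ℓ}` (closure of `Ω = {0 < y < x < ℓ}`): it is `C²` on
the closed triangle, satisfies the hyperbolic equation
`a(x)∂ₓ²K − ∂_y²(a(y)K) = (q(x) − p(y))K` in `Ω`, the boundary condition
`a(0)∂_yK(x,0) + a'(0)K(x,0) = 0`, the diagonal condition
`2a(x)(d/dx)K(x,x) + a'(x)K(x,x) = q(x) − p(x)` for `0 < x < ℓ`, and `K(0,0)=0`. -/
def IsGoursatSol (ℓ : ℝ) (a p q : ℝ → ℝ) (K : ℝ → ℝ → ℝ) : Prop :=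
  ContDiffOn ℝ 2 (fun z : ℝ × ℝ => K z.1 z.2)
      {z : ℝ × ℝ | 0 ≤ z.2 ∧ z.2 ≤ z.1 ∧ z.1 ≤ ℓ} ∧
  (∀ x y : ℝ, 0 < y → y < x → x < ℓ →
      a x * deriv (fun s => deriv (fun s' => K s' y) s) x
        - deriv (fun s => deriv (fun s' => a s' * K x s') s) y
        = (q x - p y) * K x y) ∧
  (∀ x : ℝ, 0 < x → x < ℓ →
      a 0 * derivWithin (fun s => K x s) (Icc 0 x) 0
        + derivWithin a (Icc 0 ℓ) 0 * K x 0 = 0) ∧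
  (∀ x : ℝ, 0 < x → x < ℓ →
      2 * a x * derivWithin (fun s => K s s) (Icc 0 ℓ) x
        + derivWithin a (Icc 0 ℓ) x * K x x = q x - p x) ∧
  K 0 0 = 0


/-- The closed triangle `{0 ≤ y ≤ x ≤ ℓ}`. -/
def triangle (ℓ : ℝ) : Set (ℝ × ℝ) := {z | 0 ≤ z.2 ∧ z.2 ≤ z.1 ∧ z.1 ≤ ℓ}

/-- The partial derivative in the first variable on the closed triangle. -/
def dxOn (ℓ : ℝ) (f : ℝ × ℝ → ℝ) (z : ℝ × ℝ) : ℝ := fderivWithin ℝ f (triangle ℓ) z (1, 0)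

/-- The partial derivative in the second variable on the closed triangle. -/
def dyOn (ℓ : ℝ) (f : ℝ × ℝ → ℝ) (z : ℝ × ℝ) : ℝ := fderivWithin ℝ f (triangle ℓ) z (0, 1)

section Triangle

variable {ℓ : ℝ} {f : ℝ × ℝ → ℝ}

theorem isCompact_triangle (ℓ : ℝ) : IsCompact (triangle ℓ) := by
  have hc : IsClosed (triangle ℓ) :=
    (isClosed_le continuous_const continuous_snd).inter
      ((isClosed_le continuous_snd continuous_fst).inter
        (isClosed_le continuous_fst continuous_const))
  refine (isCompact_Icc.prod isCompact_Icc : IsCompact (Icc 0 ℓ ×ˢ Icc 0 ℓ)).of_isClosed_subset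
    hc fun z hz => ?_
  obtain ⟨h1, h2, h3⟩ := hz
  exact ⟨⟨h1.trans h2, h3⟩, ⟨h1, h2.trans h3⟩⟩

theorem isOpen_openTriangle (ℓ : ℝ) : IsOpen {z : ℝ × ℝ | 0 < z.2 ∧ z.2 < z.1 ∧ z.1 < ℓ} :=
  (isOpen_lt continuous_const continuous_snd).inter
    ((isOpen_lt continuous_snd continuous_fst).inter
      (isOpen_lt continuous_fst continuous_const))

theorem mem_interior_triangle {z : ℝ × ℝ} (h0 : 0 < z.2) (h1 : z.2 < z.1) (h2 : z.1 < ℓ) :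
    z ∈ interior (triangle ℓ) :=
  interior_maximal (s := triangle ℓ)
    (fun _ (hw : _ ∧ _ ∧ _) => ⟨hw.1.le, hw.2.1.le, hw.2.2.le⟩) (isOpen_openTriangle ℓ)
    ⟨h0, h1, h2⟩

theorem uniqueDiffOn_triangle (hℓ : 0 < ℓ) : UniqueDiffOn ℝ (triangle ℓ) := by
  refine uniqueDiffOn_convex ?_
    (nonempty_of_mem (mem_interior_triangle (z := (ℓ / 2, ℓ / 4)) ?_ ?_ ?_))
  · intro z hz w hw s t hs ht hst
    obtain ⟨h1, h2, h3⟩ := hz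
    obtain ⟨k1, k2, k3⟩ := hw
    refine ⟨?_, ?_, ?_⟩ <;> simp only [Prod.fst_add, Prod.snd_add, Prod.smul_fst, Prod.smul_snd,
      smul_eq_mul]
    · positivity
    · gcongr
    · calc s * z.1 + t * w.1 ≤ s * ℓ + t * ℓ := by gcongr
        _ = ℓ := by rw [← add_mul, hst, one_mul]
  all_goals dsimp only; linarith

theorem contDiffOn_dxOn (hℓ : 0 < ℓ) {m n : WithTop ℕ∞} (hf : ContDiffOn ℝ n f (triangle ℓ))
    (hmn : m + 1 ≤ n) : ContDiffOn ℝ m (dxOn ℓ f) (triangle ℓ) :=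
  (hf.fderivWithin (uniqueDiffOn_triangle hℓ) hmn).clm_apply contDiffOn_const

theorem contDiffOn_dyOn (hℓ : 0 < ℓ) {m n : WithTop ℕ∞} (hf : ContDiffOn ℝ n f (triangle ℓ))
    (hmn : m + 1 ≤ n) : ContDiffOn ℝ m (dyOn ℓ f) (triangle ℓ) :=
  (hf.fderivWithin (uniqueDiffOn_triangle hℓ) hmn).clm_apply contDiffOn_const

theorem hasDerivWithinAt_comp_triangle (hf : DifferentiableOn ℝ f (triangle ℓ))
    {γ₁ γ₂ : ℝ → ℝ} {v₁ v₂ t : ℝ} {s : Set ℝ} (h₁ : HasDerivWithinAt γ₁ v₁ s t)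
    (h₂ : HasDerivWithinAt γ₂ v₂ s t) (hγ : ∀ r ∈ s, (γ₁ r, γ₂ r) ∈ triangle ℓ) (ht : t ∈ s) :
    HasDerivWithinAt (fun r => f (γ₁ r, γ₂ r))
      (v₁ * dxOn ℓ f (γ₁ t, γ₂ t) + v₂ * dyOn ℓ f (γ₁ t, γ₂ t)) s t := by
  have h := (hf _ (hγ t ht)).hasFDerivWithinAt.comp_hasDerivWithinAt t (h₁.prodMk h₂) hγ
  refine h.congr_deriv ?_
  have hv : ((v₁, v₂) : ℝ × ℝ) = v₁ • (1, 0) + v₂ • (0, 1) := by simp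
  rw [hv, map_add, map_smul, map_smul]
  rfl

theorem hasDerivWithinAt_dyOn (hf : DifferentiableOn ℝ f (triangle ℓ)) {x y : ℝ} (hx : x ≤ ℓ)
    (hy : y ∈ Icc 0 x) :
    HasDerivWithinAt (fun s => f (x, s)) (dyOn ℓ f (x, y)) (Icc 0 x) y := by
  simpa using hasDerivWithinAt_comp_triangle hf (hasDerivWithinAt_const y (Icc 0 x) x)
    (hasDerivWithinAt_id y (Icc 0 x)) (fun r hr => ⟨hr.1, hr.2, hx⟩) hy

theorem hasDerivWithinAt_dxOn (hf : DifferentiableOn ℝ f (triangle ℓ)) {x y : ℝ} (hy : 0 ≤ y)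
    (hx : x ∈ Icc y ℓ) :
    HasDerivWithinAt (fun s => f (s, y)) (dxOn ℓ f (x, y)) (Icc y ℓ) x := by
  simpa using hasDerivWithinAt_comp_triangle hf (hasDerivWithinAt_id x (Icc y ℓ))
    (hasDerivWithinAt_const x (Icc y ℓ) y) (fun r hr => ⟨hy, hr.1, hr.2⟩) hx

theorem hasDerivAt_dyOn (hf : DifferentiableOn ℝ f (triangle ℓ)) {x y : ℝ} (hx : x ≤ ℓ)
    (hy : y ∈ Ioo 0 x) : HasDerivAt (fun s => f (x, s)) (dyOn ℓ f (x, y)) y :=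
  (hasDerivWithinAt_dyOn hf hx ⟨hy.1.le, hy.2.le⟩).hasDerivAt (Icc_mem_nhds hy.1 hy.2)

theorem hasDerivAt_dxOn (hf : DifferentiableOn ℝ f (triangle ℓ)) {x y : ℝ} (hy : 0 ≤ y)
    (hx : x ∈ Ioo y ℓ) : HasDerivAt (fun s => f (s, y)) (dxOn ℓ f (x, y)) x :=
  (hasDerivWithinAt_dxOn hf hy ⟨hx.1.le, hx.2.le⟩).hasDerivAt (Icc_mem_nhds hx.1 hx.2)

theorem hasDerivWithinAt_diag (hf : DifferentiableOn ℝ f (triangle ℓ)) {x : ℝ}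
    (hx : x ∈ Icc 0 ℓ) :
    HasDerivWithinAt (fun s => f (s, s)) (dxOn ℓ f (x, x) + dyOn ℓ f (x, x)) (Icc 0 ℓ) x := by
  simpa using hasDerivWithinAt_comp_triangle hf (hasDerivWithinAt_id x (Icc 0 ℓ))
    (hasDerivWithinAt_id x (Icc 0 ℓ)) (fun r hr => ⟨hr.1, le_rfl, hr.2⟩) hx

theorem deriv_deriv_fst (hℓ : 0 < ℓ) (hf : ContDiffOn ℝ 2 f (triangle ℓ)) {x y : ℝ}
    (hy : 0 ≤ y) (hx : x ∈ Ioo y ℓ) :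
    deriv (fun s => deriv (fun s' => f (s', y)) s) x = dxOn ℓ (dxOn ℓ f) (x, y) := by
  have h1 := (contDiffOn_dxOn (m := 1) hℓ hf (by norm_num)).differentiableOn one_ne_zero
  rw [← (hasDerivAt_dxOn h1 hy hx).deriv]
  refine Filter.EventuallyEq.deriv_eq ?_
  filter_upwards [Ioo_mem_nhds hx.1 hx.2] with s hs
  exact (hasDerivAt_dxOn (hf.differentiableOn two_ne_zero) hy hs).deriv

theorem deriv_deriv_snd (hℓ : 0 < ℓ) (hf : ContDiffOn ℝ 2 f (triangle ℓ)) {x y : ℝ}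
    (hx : x ≤ ℓ) (hy : y ∈ Ioo 0 x) :
    deriv (fun s => deriv (fun s' => f (x, s')) s) y = dyOn ℓ (dyOn ℓ f) (x, y) := by
  have h1 := (contDiffOn_dyOn (m := 1) hℓ hf (by norm_num)).differentiableOn one_ne_zero
  rw [← (hasDerivAt_dyOn h1 hx hy).deriv]
  refine Filter.EventuallyEq.deriv_eq ?_
  filter_upwards [Ioo_mem_nhds hy.1 hy.2] with s hs
  exact (hasDerivAt_dyOn (hf.differentiableOn two_ne_zero) hx hs).deriv

theorem dxOn_dyOn_comm (hℓ : 0 < ℓ) (hf : ContDiffOn ℝ 2 f (triangle ℓ)) {z : ℝ × ℝ}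
    (hz : z ∈ interior (triangle ℓ)) : dxOn ℓ (dyOn ℓ f) z = dyOn ℓ (dxOn ℓ f) z := by
  have hu := uniqueDiffOn_triangle hℓ
  have hzT := interior_subset hz
  have hd : DifferentiableWithinAt ℝ (fderivWithin ℝ f (triangle ℓ)) (triangle ℓ) z :=
    (hf.fderivWithin (m := 1) hu (by norm_num)).differentiableOn one_ne_zero z hzT
  have key : ∀ v w : ℝ × ℝ,
      fderivWithin ℝ (fun z => fderivWithin ℝ f (triangle ℓ) z v) (triangle ℓ) z w =
        fderivWithin ℝ (fderivWithin ℝ f (triangle ℓ)) (triangle ℓ) z w v := fun v w => by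
    rw [fderivWithin_clm_apply (hu z hzT) hd (differentiableWithinAt_const v)]
    simp
  exact (key _ _).trans (((hf z hzT).isSymmSndFDerivWithinAt (by simp) hu
    (subset_closure hz) hzT (1, 0) (0, 1)).trans (key _ _).symm)

theorem continuousOn_slice (hf : ContinuousOn f (triangle ℓ)) {x : ℝ} (hx : x ≤ ℓ) :
    ContinuousOn (fun y => f (x, y)) (Icc 0 x) :=
  hf.comp (by fun_prop) fun _ hy => ⟨hy.1, hy.2, hx⟩

theorem intervalIntegrable_slice (hf : ContinuousOn f (triangle ℓ)) {x : ℝ} (h0 : 0 ≤ x)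
    (hx : x ≤ ℓ) : IntervalIntegrable (fun y => f (x, y)) volume 0 x :=
  (by simpa [uIcc_of_le h0] using continuousOn_slice hf hx :
    ContinuousOn (fun y => f (x, y)) (uIcc 0 x)).intervalIntegrable

theorem integral_dyOn (hℓ : 0 < ℓ) (hf : ContDiffOn ℝ 1 f (triangle ℓ)) {x y z : ℝ}
    (hy : 0 ≤ y) (hyz : y ≤ z) (hz : z ≤ x) (hx : x ≤ ℓ) :
    ∫ s in y..z, dyOn ℓ f (x, s) = f (x, z) - f (x, y) := by
  have hsub : Icc y z ⊆ Icc 0 x := Icc_subset_Icc hy hz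
  refine integral_eq_sub_of_hasDerivAt_of_le hyz
    ((continuousOn_slice hf.continuousOn hx).mono hsub)
    (fun s hs => hasDerivAt_dyOn (hf.differentiableOn one_ne_zero) hx
      ⟨hy.trans_lt hs.1, hs.2.trans_le hz⟩) ?_
  refine ContinuousOn.intervalIntegrable ?_
  rw [uIcc_of_le hyz]
  exact (continuousOn_slice (contDiffOn_dyOn (m := 0) hℓ hf (by norm_num)).continuousOn hx).mono
    hsub

theorem integral_slice_eq_mul (f : ℝ × ℝ → ℝ) (x : ℝ) :
    ∫ y in (0 : ℝ)..x, f (x, y) = x * ∫ t in (0 : ℝ)..1, f (x, x * t) := by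
  have h := mul_integral_comp_mul_left (a := 0) (b := 1) (f := fun y => f (x, y)) x
  simpa using h.symm

theorem continuousOn_slice_mul (hf : ContinuousOn f (triangle ℓ)) {x : ℝ} (hx : x ∈ Icc 0 ℓ) :
    ContinuousOn (fun t => f (x, x * t)) (Icc 0 1) :=
  hf.comp (by fun_prop) fun _ ht =>
    ⟨mul_nonneg hx.1 ht.1, mul_le_of_le_one_right hx.1 ht.2, hx.2⟩

theorem continuousOn_integral_slice (hℓ : 0 ≤ ℓ) (hf : ContinuousOn f (triangle ℓ)) :
    ContinuousOn (fun x => ∫ y in (0 : ℝ)..x, f (x, y)) (Icc 0 ℓ) := by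
  have hg : Continuous (Function.uncurry fun x t : ℝ =>
      f ((projIcc 0 ℓ hℓ x : ℝ), (projIcc 0 ℓ hℓ x : ℝ) * (projIcc 0 1 zero_le_one t : ℝ))) := by
    refine hf.comp_continuous (f := fun w : ℝ × ℝ => ((projIcc 0 ℓ hℓ w.1 : ℝ),
      (projIcc 0 ℓ hℓ w.1 : ℝ) * (projIcc 0 1 zero_le_one w.2 : ℝ))) ?_ ?_
    · have h1 := continuous_projIcc (h := hℓ)
      have h2 := continuous_projIcc (h := zero_le_one (α := ℝ))
      fun_prop
    · intro w
      have h1 := (projIcc 0 ℓ hℓ w.1).2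
      have h2 := (projIcc 0 1 (zero_le_one (α := ℝ)) w.2).2
      exact ⟨mul_nonneg h1.1 h2.1, mul_le_of_le_one_right h1.1 h2.2, h1.2⟩
  have hc := continuous_parametric_intervalIntegral_of_continuous' (μ := volume) hg 0 1
  refine (continuousOn_id.mul hc.continuousOn).congr fun x hx => ?_
  rw [integral_slice_eq_mul]
  refine congrArg (x * ·) ?_
  refine integral_congr fun t ht => ?_
  rw [uIcc_of_le zero_le_one] at ht
  simp only [projIcc_of_mem hℓ hx, projIcc_of_mem zero_le_one ht]

/-- Leibniz rule for the integral over the slices of the triangle. -/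
theorem hasDerivAt_integral_slice (hℓ : 0 < ℓ) (hf : ContDiffOn ℝ 1 f (triangle ℓ)) {x : ℝ}
    (hx : x ∈ Ioo 0 ℓ) :
    HasDerivAt (fun x => ∫ y in (0 : ℝ)..x, f (x, y))
      (f (x, x) + ∫ y in (0 : ℝ)..x, dxOn ℓ f (x, y)) x := by
  have hd := hf.differentiableOn one_ne_zero
  have hcx := (contDiffOn_dxOn (m := 0) hℓ hf (by norm_num)).continuousOn
  have hcy := (contDiffOn_dyOn (m := 0) hℓ hf (by norm_num)).continuousOn
  obtain ⟨Bx, hBx⟩ := (isCompact_triangle ℓ).exists_bound_of_continuousOn hcx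
  obtain ⟨By, hBy⟩ := (isCompact_triangle ℓ).exists_bound_of_continuousOn hcy
  have hmem : ∀ s ∈ Icc 0 ℓ, ∀ t ∈ Icc (0 : ℝ) 1, (s, s * t) ∈ triangle ℓ := fun s hs t ht =>
    ⟨mul_nonneg hs.1 ht.1, mul_le_of_le_one_right hs.1 ht.2, hs.2⟩
  have hI : uIoc (0 : ℝ) 1 ⊆ Icc 0 1 := by
    rw [uIoc_of_le zero_le_one]; exact Ioc_subset_Icc_self
  have hinteg : ∀ g : ℝ → ℝ, ContinuousOn g (Icc 0 1) → IntervalIntegrable g volume 0 1 :=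
    fun g hg => ContinuousOn.intervalIntegrable (by rwa [uIcc_of_le zero_le_one])
  have hxI : x ∈ Icc 0 ℓ := Ioo_subset_Icc_self hx
  have hcF' : ContinuousOn (fun t => dxOn ℓ f (x, x * t) + t * dyOn ℓ f (x, x * t)) (Icc 0 1) :=
    (continuousOn_slice_mul hcx hxI).add (continuousOn_id.mul (continuousOn_slice_mul hcy hxI))
  have hder := (hasDerivAt_integral_of_dominated_loc_of_deriv_le (μ := volume) (a := 0) (b := 1)
    (F := fun s t => f (s, s * t))
    (F' := fun s t => dxOn ℓ f (s, s * t) + t * dyOn ℓ f (s, s * t))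
    (bound := fun _ => Bx + By) (Ioo_mem_nhds hx.1 hx.2)
    (by
      filter_upwards [Ioo_mem_nhds hx.1 hx.2] with s hs
      exact ((continuousOn_slice_mul hf.continuousOn (Ioo_subset_Icc_self hs)).mono
        hI).aestronglyMeasurable measurableSet_uIoc)
    (hinteg _ (continuousOn_slice_mul hf.continuousOn hxI))
    ((hcF'.mono hI).aestronglyMeasurable measurableSet_uIoc)
    (Filter.Eventually.of_forall fun t ht s hs => by
      have hm := hmem s (Ioo_subset_Icc_self hs) t (hI ht)
      refine (norm_add_le _ _).trans (add_le_add (hBx _ hm) ?_)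
      rw [norm_mul]
      refine (mul_le_of_le_one_left (norm_nonneg _) ?_).trans (hBy _ hm)
      rw [Real.norm_of_nonneg (hI ht).1]
      exact (hI ht).2)
    intervalIntegrable_const
    (Filter.Eventually.of_forall fun t ht s hs => by
      have hw := hasDerivWithinAt_comp_triangle hd (hasDerivWithinAt_id s (Icc 0 ℓ))
        ((hasDerivWithinAt_id s (Icc 0 ℓ)).mul_const t) (fun r hr => hmem r hr t (hI ht))
        (Ioo_subset_Icc_self hs)
      simpa using hw.hasDerivAt (Icc_mem_nhds hs.1 hs.2))).2
  have hparts : ∫ t in (0 : ℝ)..1, (f (x, x * t) + t * (x * dyOn ℓ f (x, x * t))) = f (x, x) := by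
    have hcont : ContinuousOn (fun t => t * f (x, x * t)) (Icc 0 1) :=
      continuousOn_id.mul (continuousOn_slice_mul hf.continuousOn hxI)
    rw [integral_eq_sub_of_hasDerivAt_of_le (f := fun t => t * f (x, x * t)) zero_le_one hcont]
    · simp
    · intro t ht
      have hw := hasDerivWithinAt_comp_triangle hd (hasDerivWithinAt_const t (Icc 0 1) x)
        ((hasDerivWithinAt_id t (Icc (0 : ℝ) 1)).const_mul x) (fun r hr => hmem x hxI r hr)
        (Ioo_subset_Icc_self ht)
      exact ((hasDerivAt_id t).mul (hw.hasDerivAt (Icc_mem_nhds ht.1 ht.2))).congr_deriv (by simp)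
    · exact hinteg _ ((continuousOn_slice_mul hf.continuousOn hxI).add
        (continuousOn_id.mul (continuousOn_const.mul (continuousOn_slice_mul hcy hxI))))
  have h := (hasDerivAt_id x).mul hder
  refine (h.congr_of_eventuallyEq (Filter.Eventually.of_forall
    fun s => integral_slice_eq_mul f s)).congr_deriv ?_
  have hy : ∫ t in (0 : ℝ)..1, t * (x * dyOn ℓ f (x, x * t)) =
      x * ∫ t in (0 : ℝ)..1, t * dyOn ℓ f (x, x * t) := by
    rw [← intervalIntegral.integral_const_mul]
    simp only [mul_left_comm x]
  have hiy : IntervalIntegrable (fun t => t * dyOn ℓ f (x, x * t)) volume 0 1 :=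
    hinteg _ (continuousOn_id.mul (continuousOn_slice_mul hcy hxI))
  have hixy : IntervalIntegrable (fun t => t * (x * dyOn ℓ f (x, x * t))) volume 0 1 :=
    hinteg _ (continuousOn_id.mul (continuousOn_const.mul (continuousOn_slice_mul hcy hxI)))
  rw [← hparts, integral_slice_eq_mul (dxOn ℓ f), id, one_mul,
    integral_add (hinteg _ (continuousOn_slice_mul hcx hxI)) hiy,
    integral_add (hinteg _ (continuousOn_slice_mul hf.continuousOn hxI)) hixy, hy]
  ring

end Triangle

section Energy

variable {ℓ : ℝ} {a : ℝ → ℝ} {U : ℝ × ℝ → ℝ}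

/-- The energy density of the wave operator `a(x)∂ₓ² − a(y)∂_y²`. -/
def energyDensity (ℓ : ℝ) (a : ℝ → ℝ) (U : ℝ × ℝ → ℝ) (z : ℝ × ℝ) : ℝ :=
  dxOn ℓ U z ^ 2 / a z.2 + dyOn ℓ U z ^ 2 / a z.1 + U z ^ 2

theorem contDiffOn_energyDensity (hℓ : 0 < ℓ) (ha : ContDiffOn ℝ 2 a (Icc 0 ℓ))
    (hapos : ∀ x ∈ Icc 0 ℓ, 0 < a x) (hU : ContDiffOn ℝ 2 U (triangle ℓ)) :
    ContDiffOn ℝ 1 (energyDensity ℓ a U) (triangle ℓ) := by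
  have hfst : MapsTo Prod.fst (triangle ℓ) (Icc 0 ℓ) := fun z hz => ⟨hz.1.trans hz.2.1, hz.2.2⟩
  have hsnd : MapsTo Prod.snd (triangle ℓ) (Icc 0 ℓ) := fun z hz => ⟨hz.1, hz.2.1.trans hz.2.2⟩
  have ha1 : ContDiffOn ℝ 1 a (Icc 0 ℓ) := ha.of_le (by norm_num)
  have hux := contDiffOn_dxOn (m := 1) hℓ hU (by norm_num)
  have huy := contDiffOn_dyOn (m := 1) hℓ hU (by norm_num)
  exact (((hux.pow 2).div (ha1.comp contDiff_snd.contDiffOn hsnd)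
      fun z hz => (hapos _ (hsnd hz)).ne').add
    ((huy.pow 2).div (ha1.comp contDiff_fst.contDiffOn hfst)
      fun z hz => (hapos _ (hfst hz)).ne')).add ((hU.of_le (by norm_num)).pow 2)

theorem dxOn_energyDensity (hℓ : 0 < ℓ) (ha : ContDiffOn ℝ 2 a (Icc 0 ℓ))
    (hapos : ∀ x ∈ Icc 0 ℓ, 0 < a x) (hU : ContDiffOn ℝ 2 U (triangle ℓ)) {x y : ℝ}
    (hy : 0 < y) (hyx : y < x) (hx : x < ℓ) :
    dxOn ℓ (energyDensity ℓ a U) (x, y) =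
      2 * dxOn ℓ U (x, y) * dxOn ℓ (dxOn ℓ U) (x, y) / a y
        + 2 * dyOn ℓ U (x, y) * dyOn ℓ (dxOn ℓ U) (x, y) / a x
        - derivWithin a (Icc 0 ℓ) x * dyOn ℓ U (x, y) ^ 2 / a x ^ 2
        + 2 * U (x, y) * dxOn ℓ U (x, y) := by
  have hI : x ∈ Ioo y ℓ := ⟨hyx, hx⟩
  have hx0 : 0 < x := hy.trans hyx
  have hux := (contDiffOn_dxOn (m := 1) hℓ hU (by norm_num)).differentiableOn one_ne_zero
  have huy := (contDiffOn_dyOn (m := 1) hℓ hU (by norm_num)).differentiableOn one_ne_zero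
  have hax := (hapos x ⟨hx0.le, hx.le⟩).ne'
  have hda : HasDerivAt a (derivWithin a (Icc 0 ℓ) x) x :=
    ((ha.differentiableOn two_ne_zero x ⟨hx0.le, hx.le⟩).hasDerivWithinAt).hasDerivAt
      (Icc_mem_nhds hx0 hx)
  have he := hasDerivAt_dxOn ((contDiffOn_energyDensity hℓ ha hapos hU).differentiableOn
    one_ne_zero) hy.le hI
  have h := ((((hasDerivAt_dxOn hux hy.le hI).pow 2).div_const (a y)).add
    (((hasDerivAt_dxOn huy hy.le hI).pow 2).div hda hax)).add
    ((hasDerivAt_dxOn (hU.differentiableOn two_ne_zero) hy.le hI).pow 2)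
  rw [he.unique h, dxOn_dyOn_comm hℓ hU (mem_interior_triangle hy hyx hx)]
  simp only [Pi.pow_apply]
  field_simp
  push_cast
  ring

theorem energy_derivative_le {ax ay a₁ u ux uy uxx uyy uxy m A A₁ M : ℝ} (hm : 0 < m)
    (hax : m ≤ ax) (hay : m ≤ ay) (hayA : ay ≤ A) (ha₁ : |a₁| ≤ A₁)
    (hwave : |ax * uxx - ay * uyy| ≤ M * |u|) (hM : 0 ≤ M) :
    2 * ux * uxx / ay + 2 * uy * uxy / ax - a₁ * uy ^ 2 / ax ^ 2 + 2 * u * ux ≤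
      2 / ax * (uxy * uy + ux * uyy) +
        ((M / m ^ 2 + 1) * (1 + A) + A₁ / m) * (ux ^ 2 / ay + uy ^ 2 / ax + u ^ 2) := by
  have hax0 : 0 < ax := hm.trans_le hax
  have hay0 : 0 < ay := hm.trans_le hay
  have hA : 0 < A := hay0.trans_le hayA
  have hA₁ : 0 ≤ A₁ := (abs_nonneg _).trans ha₁
  obtain ⟨r, hr⟩ : ∃ r, r = ax * uxx - ay * uyy := ⟨_, rfl⟩
  rw [← hr] at hwave
  have hsplit : 2 * ux * uxx / ay = 2 / ax * (ux * uyy) + 2 * (ux * r) / (ax * ay) := by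
    rw [hr]; field_simp; ring
  have hforce : 2 * (ux * r) / (ax * ay) ≤ M / m ^ 2 * (ux ^ 2 + u ^ 2) := by
    have h1 : 2 * (ux * r) ≤ M * (ux ^ 2 + u ^ 2) := by
      have h2 : ux * r ≤ |ux| * (M * |u|) := (le_abs_self _).trans (by rw [abs_mul]; gcongr)
      have h3 : 2 * (|ux| * |u|) ≤ ux ^ 2 + u ^ 2 := by
        rw [← sq_abs ux, ← sq_abs u]; nlinarith [sq_nonneg (|ux| - |u|)]
      nlinarith [mul_le_mul_of_nonneg_left h3 hM]
    have h4 : m ^ 2 ≤ ax * ay := by rw [sq]; gcongr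
    calc 2 * (ux * r) / (ax * ay) ≤ M * (ux ^ 2 + u ^ 2) / (ax * ay) := by gcongr
      _ ≤ M * (ux ^ 2 + u ^ 2) / m ^ 2 := by gcongr
      _ = _ := by ring
  have hcoef : -(a₁ * uy ^ 2 / ax ^ 2) ≤ A₁ / m * (uy ^ 2 / ax) := by
    have h1 : -a₁ ≤ A₁ := (neg_le_abs a₁).trans ha₁
    calc -(a₁ * uy ^ 2 / ax ^ 2) = -a₁ / ax * (uy ^ 2 / ax) := by field_simp
      _ ≤ A₁ / ax * (uy ^ 2 / ax) := by gcongr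
      _ ≤ A₁ / m * (uy ^ 2 / ax) := by gcongr
  have hcross : 2 * u * ux ≤ ux ^ 2 + u ^ 2 := by nlinarith [sq_nonneg (u - ux)]
  have hux : ux ^ 2 ≤ A * (ux ^ 2 / ay) := by
    calc ux ^ 2 = ay * (ux ^ 2 / ay) := by field_simp
      _ ≤ A * (ux ^ 2 / ay) := by gcongr
  have hP : 0 ≤ ux ^ 2 / ay := by positivity
  have hQ : 0 ≤ uy ^ 2 / ax := by positivity
  have hk : 0 ≤ M / m ^ 2 := by positivity
  have hA₁m : 0 ≤ A₁ / m := by positivity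
  have hmix : 2 * uy * uxy / ax = 2 / ax * (uxy * uy) := by field_simp
  rw [hsplit, hmix]
  generalize ux ^ 2 / ay = P at *
  generalize uy ^ 2 / ax = Q at *
  generalize M / m ^ 2 = k at *
  generalize A₁ / m = j at *
  have hsum : (k + 1) * (ux ^ 2 + u ^ 2) ≤ (k + 1) * ((1 + A) * (P + Q + u ^ 2)) := by
    gcongr
    nlinarith [sq_nonneg u, mul_nonneg hA.le (sq_nonneg u), mul_nonneg hA.le hQ]
  nlinarith [mul_nonneg hA₁m hP, mul_nonneg hA₁m (sq_nonneg u)]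

/-- Energy inequality: the growth of the energy on a slice is controlled by the data on the
characteristic diagonal, when the lower boundary carries a Neumann condition. -/
theorem energy_flux_le (hℓ : 0 < ℓ) (ha : ContDiffOn ℝ 2 a (Icc 0 ℓ)) {m A A₁ M : ℝ}
    (hm : 0 < m) (ham : ∀ x ∈ Icc 0 ℓ, m ≤ a x) (haA : ∀ x ∈ Icc 0 ℓ, a x ≤ A)
    (ha₁ : ∀ x ∈ Icc 0 ℓ, |derivWithin a (Icc 0 ℓ) x| ≤ A₁) (hM : 0 ≤ M)
    (hU : ContDiffOn ℝ 2 U (triangle ℓ)) {x : ℝ} (hx : x ∈ Ioo 0 ℓ)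
    (hwave : ∀ y ∈ Ioo 0 x, |a x * dxOn ℓ (dxOn ℓ U) (x, y) - a y * dyOn ℓ (dyOn ℓ U) (x, y)| ≤
      M * |U (x, y)|)
    (hneumann : dyOn ℓ U (x, 0) = 0) :
    energyDensity ℓ a U (x, x) + ∫ y in (0 : ℝ)..x, dxOn ℓ (energyDensity ℓ a U) (x, y) ≤
      (dxOn ℓ U (x, x) + dyOn ℓ U (x, x)) ^ 2 / a x + U (x, x) ^ 2 +
        ((M / m ^ 2 + 1) * (1 + A) + A₁ / m) *
          ∫ y in (0 : ℝ)..x, energyDensity ℓ a U (x, y) := by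
  have hapos : ∀ x ∈ Icc 0 ℓ, 0 < a x := fun x hx => hm.trans_le (ham x hx)
  have hxI : x ∈ Icc 0 ℓ := Ioo_subset_Icc_self hx
  have hE := contDiffOn_energyDensity hℓ ha hapos hU
  have hux := contDiffOn_dxOn (m := 1) hℓ hU (by norm_num)
  have huy := contDiffOn_dyOn (m := 1) hℓ hU (by norm_num)
  have hP : ContDiffOn ℝ 1 (fun z => dxOn ℓ U z * dyOn ℓ U z) (triangle ℓ) := hux.mul huy
  have hiE := intervalIntegrable_slice hE.continuousOn hx.1.le hx.2.le
  have hiE' := intervalIntegrable_slice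
    (contDiffOn_dxOn (m := 0) hℓ hE (by norm_num)).continuousOn hx.1.le hx.2.le
  have hiP := intervalIntegrable_slice
    (contDiffOn_dyOn (m := 0) hℓ hP (by norm_num)).continuousOn hx.1.le hx.2.le
  have hle : ∫ y in (0 : ℝ)..x, dxOn ℓ (energyDensity ℓ a U) (x, y) ≤
      ∫ y in (0 : ℝ)..x, (2 / a x * dyOn ℓ (fun z => dxOn ℓ U z * dyOn ℓ U z) (x, y) +
        ((M / m ^ 2 + 1) * (1 + A) + A₁ / m) * energyDensity ℓ a U (x, y)) := by
    refine integral_mono_on_of_le_Ioo hx.1.le hiE'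
      ((hiP.const_mul _).add (hiE.const_mul _)) fun y hy => ?_
    have hyI : y ∈ Icc 0 ℓ := ⟨hy.1.le, (hy.2.trans hx.2).le⟩
    have hPy : dyOn ℓ (fun z => dxOn ℓ U z * dyOn ℓ U z) (x, y) =
        dyOn ℓ (dxOn ℓ U) (x, y) * dyOn ℓ U (x, y) +
          dxOn ℓ U (x, y) * dyOn ℓ (dyOn ℓ U) (x, y) :=
      (hasDerivAt_dyOn (hP.differentiableOn one_ne_zero) hx.2.le hy).unique
        ((hasDerivAt_dyOn (hux.differentiableOn one_ne_zero) hx.2.le hy).mul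
          (hasDerivAt_dyOn (huy.differentiableOn one_ne_zero) hx.2.le hy))
    rw [hPy, dxOn_energyDensity hℓ ha hapos hU hy.1 hy.2 hx.2]
    exact energy_derivative_le hm (ham x hxI) (ham y hyI) (haA y hyI) (ha₁ x hxI) (hwave y hy) hM
  rw [integral_add (hiP.const_mul _) (hiE.const_mul _), intervalIntegral.integral_const_mul,
    intervalIntegral.integral_const_mul, integral_dyOn hℓ hP le_rfl hx.1.le le_rfl hx.2.le,
    hneumann] at hle
  have hdiag : (dxOn ℓ U (x, x) + dyOn ℓ U (x, x)) ^ 2 / a x + U (x, x) ^ 2 =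
      energyDensity ℓ a U (x, x) + 2 / a x * (dxOn ℓ U (x, x) * dyOn ℓ U (x, x)) := by
    simp only [energyDensity]; ring
  rw [hdiag]
  linarith

theorem le_mul_exp_of_deriv_le {E E' : ℝ → ℝ} {b C H : ℝ} (hC : 0 ≤ C) (hH : 0 ≤ H)
    (hE : ContinuousOn E (Icc 0 b)) (h0 : E 0 = 0)
    (hd : ∀ x ∈ Ioo 0 b, HasDerivAt E (E' x) x)
    (hle : ∀ x ∈ Ioo 0 b, E' x ≤ H + C * E x) {x : ℝ} (hx : x ∈ Icc 0 b) :
    E x ≤ H * x * Real.exp (C * x) := by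
  have hder : ∀ t ∈ Ioo 0 b, HasDerivAt (fun t => Real.exp (-(C * t)) * E t - H * t)
      (Real.exp (-(C * t)) * (E' t - C * E t) - H) t := fun t ht => by
    have h1 := (((hasDerivAt_id t).const_mul C).fun_neg.exp.mul (hd t ht)).sub
      ((hasDerivAt_id t).const_mul H)
    exact h1.congr_deriv (by simp; ring)
  have hanti : AntitoneOn (fun t => Real.exp (-(C * t)) * E t - H * t) (Icc 0 b) := by
    refine antitoneOn_of_deriv_nonpos (convex_Icc 0 b) ?_ ?_ ?_
    · exact ((by fun_prop : Continuous fun t => Real.exp (-(C * t))).continuousOn.mul hE).sub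
        (by fun_prop)
    · rw [interior_Icc]
      exact fun t ht => (hder t ht).differentiableAt.differentiableWithinAt
    · rw [interior_Icc]
      intro t ht
      rw [(hder t ht).deriv]
      have h1 : Real.exp (-(C * t)) ≤ 1 := Real.exp_le_one_iff.2 (by nlinarith [ht.1])
      have h2 : E' t - C * E t ≤ H := by linarith [hle t ht]
      nlinarith [mul_le_mul_of_nonneg_left h2 (Real.exp_pos (-(C * t))).le,
        mul_le_mul_of_nonneg_right h1 hH]
  have h := hanti (left_mem_Icc.2 (hx.1.trans hx.2)) hx hx.1
  simp only [h0, mul_zero, sub_zero, sub_nonpos] at h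
  have h2 := mul_le_mul_of_nonneg_right h (Real.exp_pos (C * x)).le
  rw [mul_right_comm, ← Real.exp_add, neg_add_cancel, Real.exp_zero, one_mul] at h2
  exact h2

theorem abs_le_of_wave (hℓ : 0 < ℓ) (ha : ContDiffOn ℝ 2 a (Icc 0 ℓ)) {m A A₁ M b N D B : ℝ}
    (hm : 0 < m) (ham : ∀ x ∈ Icc 0 ℓ, m ≤ a x) (haA : ∀ x ∈ Icc 0 ℓ, a x ≤ A)
    (ha₁ : ∀ x ∈ Icc 0 ℓ, |derivWithin a (Icc 0 ℓ) x| ≤ A₁) (hM : 0 ≤ M)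
    (hU : ContDiffOn ℝ 2 U (triangle ℓ)) (hb : b ≤ ℓ) (hN : 0 < N) (hD : 0 ≤ D)
    (hwave : ∀ x y, 0 < y → y < x → x < b →
      |a x * dxOn ℓ (dxOn ℓ U) (x, y) - a y * dyOn ℓ (dyOn ℓ U) (x, y)| ≤ M * |U (x, y)|)
    (hneumann : ∀ x ∈ Ioo 0 b, dyOn ℓ U (x, 0) = 0)
    (hdiag : ∀ x ∈ Icc 0 b, |U (x, x)| ≤ D * x * N)
    (hdiag' : ∀ x ∈ Ioo 0 b, |dxOn ℓ U (x, x) + dyOn ℓ U (x, x)| ≤ B * N)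
    {x y : ℝ} (hy : 0 ≤ y) (hyx : y ≤ x) (hx : x ≤ b) :
    |U (x, y)| ≤ (D + 1 / 2 + A * (B ^ 2 / m + (D * ℓ) ^ 2) *
      Real.exp (((M / m ^ 2 + 1) * (1 + A) + A₁ / m) * ℓ) / 2) * x * N := by
  have hapos : ∀ x ∈ Icc 0 ℓ, 0 < a x := fun x hx => hm.trans_le (ham x hx)
  have hx0 : 0 ≤ x := hy.trans hyx
  have hxl : x ≤ ℓ := hx.trans hb
  have hA : 0 < A := (hapos 0 ⟨le_rfl, hℓ.le⟩).trans_le (haA 0 ⟨le_rfl, hℓ.le⟩)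
  have hA₁ : 0 ≤ A₁ := (abs_nonneg _).trans (ha₁ 0 ⟨le_rfl, hℓ.le⟩)
  set C := (M / m ^ 2 + 1) * (1 + A) + A₁ / m with hC
  have hC0 : 0 ≤ C := by positivity
  set H := B ^ 2 / m + (D * ℓ) ^ 2 with hH
  have hH0 : 0 ≤ H := by positivity
  have hE := contDiffOn_energyDensity hℓ ha hapos hU
  have henergy : ∫ s in (0 : ℝ)..x, energyDensity ℓ a U (x, s) ≤
      H * N ^ 2 * x * Real.exp (C * x) := by
    refine le_mul_exp_of_deriv_le (b := b) (E := fun x => ∫ s in (0 : ℝ)..x,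
      energyDensity ℓ a U (x, s)) hC0 (by positivity) ((continuousOn_integral_slice hℓ.le
        hE.continuousOn).mono (Icc_subset_Icc_right hb)) (by simp)
      (fun t ht => hasDerivAt_integral_slice hℓ hE ⟨ht.1, ht.2.trans_le hb⟩)
      (fun t ht => ?_) ⟨hx0, hx⟩
    have htl : t ∈ Ioo 0 ℓ := ⟨ht.1, ht.2.trans_le hb⟩
    refine (energy_flux_le hℓ ha hm ham haA ha₁ hM hU htl
      (fun s hs => hwave t s hs.1 hs.2 ht.2) (hneumann t ht)).trans ?_
    gcongr
    have h1 : (dxOn ℓ U (t, t) + dyOn ℓ U (t, t)) ^ 2 ≤ (B * N) ^ 2 :=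
      sq_le_sq' (abs_le.1 (hdiag' t ht)).1 (abs_le.1 (hdiag' t ht)).2
    have h2 : U (t, t) ^ 2 ≤ (D * ℓ * N) ^ 2 := by
      have h3 : |U (t, t)| ≤ D * ℓ * N := (hdiag t ⟨ht.1.le, ht.2.le⟩).trans
        (by gcongr; exact htl.2.le)
      exact sq_le_sq' (abs_le.1 h3).1 (abs_le.1 h3).2
    calc (dxOn ℓ U (t, t) + dyOn ℓ U (t, t)) ^ 2 / a t + U (t, t) ^ 2
        ≤ (B * N) ^ 2 / m + (D * ℓ * N) ^ 2 := by
          gcongr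
          exact ham t (Ioo_subset_Icc_self htl)
      _ = H * N ^ 2 := by rw [hH]; ring
  have huy : ContinuousOn (dyOn ℓ U) (triangle ℓ) :=
    (contDiffOn_dyOn (m := 0) hℓ hU (by norm_num)).continuousOn
  have hslope : |∫ s in y..x, dyOn ℓ U (x, s)| ≤
      ∫ s in (0 : ℝ)..x, (N / 2 + A / (2 * N) * energyDensity ℓ a U (x, s)) := by
    have hi := intervalIntegrable_slice huy hx0 hxl
    calc |∫ s in y..x, dyOn ℓ U (x, s)| ≤ ∫ s in y..x, |dyOn ℓ U (x, s)| :=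
          abs_integral_le_integral_abs hyx
      _ ≤ ∫ s in (0 : ℝ)..x, |dyOn ℓ U (x, s)| :=
          integral_mono_interval hy hyx le_rfl
            (Filter.Eventually.of_forall fun _ => abs_nonneg _) hi.abs
      _ ≤ _ := by
          refine integral_mono_on hx0 hi.abs (intervalIntegrable_const.add
            ((intervalIntegrable_slice hE.continuousOn hx0 hxl).const_mul _)) fun s hs => ?_
          have hax := hapos x ⟨hx0, hxl⟩
          have hay := hapos s ⟨hs.1, hs.2.trans hxl⟩
          have h1 : dyOn ℓ U (x, s) ^ 2 ≤ A * energyDensity ℓ a U (x, s) := by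
            have h2 : dyOn ℓ U (x, s) ^ 2 / a x ≤ energyDensity ℓ a U (x, s) := by
              have h3 : 0 ≤ dxOn ℓ U (x, s) ^ 2 / a s := by positivity
              simp only [energyDensity]
              nlinarith [sq_nonneg (U (x, s))]
            calc dyOn ℓ U (x, s) ^ 2 = a x * (dyOn ℓ U (x, s) ^ 2 / a x) := by field_simp
              _ ≤ A * energyDensity ℓ a U (x, s) := by
                gcongr
                exact haA x ⟨hx0, hxl⟩
          have h4 : A / (2 * N) * energyDensity ℓ a U (x, s) =
              A * energyDensity ℓ a U (x, s) / (2 * N) := by ring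
          have h5 : N / 2 + A * energyDensity ℓ a U (x, s) / (2 * N) =
              (N ^ 2 + A * energyDensity ℓ a U (x, s)) / (2 * N) := by field_simp
          rw [h4, h5, le_div_iff₀ (by positivity)]
          rw [← sq_abs] at h1
          nlinarith [sq_nonneg (|dyOn ℓ U (x, s)| - N)]
  rw [integral_add intervalIntegrable_const
    ((intervalIntegrable_slice hE.continuousOn hx0 hxl).const_mul _),
    intervalIntegral.integral_const, intervalIntegral.integral_const_mul, smul_eq_mul,
    sub_zero] at hslope
  have hexp : Real.exp (C * x) ≤ Real.exp (C * ℓ) := by gcongr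
  have hen : A / (2 * N) * ∫ s in (0 : ℝ)..x, energyDensity ℓ a U (x, s) ≤
      A * H * Real.exp (C * ℓ) / 2 * x * N := by
    calc _ ≤ A / (2 * N) * (H * N ^ 2 * x * Real.exp (C * ℓ)) := by
          gcongr
          exact henergy.trans (by gcongr)
      _ = _ := by field_simp
  have hftc := integral_dyOn hℓ (hU.of_le (by norm_num) : ContDiffOn ℝ 1 U (triangle ℓ))
    hy hyx le_rfl hxl
  have hUeq : U (x, y) = U (x, x) - ∫ s in y..x, dyOn ℓ U (x, s) := by rw [hftc]; ring
  have htri : |U (x, y)| ≤ |U (x, x)| + |∫ s in y..x, dyOn ℓ U (x, s)| := by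
    rw [hUeq]; exact abs_sub _ _
  nlinarith [hdiag x ⟨hx0, hx⟩]

end Energy

section Goursat

theorem abs_le_of_transport {a a' φ φ' r : ℝ → ℝ} {m b N : ℝ} (hm : 0 < m)
    (ha : ContinuousOn a (Icc 0 b)) (ham : ∀ x ∈ Icc 0 b, m ≤ a x)
    (hda : ∀ x ∈ Ioo 0 b, HasDerivAt a (a' x) x)
    (hφ : ContinuousOn φ (Icc 0 b)) (hdφ : ∀ x ∈ Ioo 0 b, HasDerivAt φ (φ' x) x)
    (h0 : φ 0 = 0) (heq : ∀ x ∈ Ioo 0 b, 2 * a x * φ' x + a' x * φ x = r x)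
    (hr : ∀ x ∈ Ioo 0 b, |r x| ≤ N) {x : ℝ} (hx : x ∈ Icc 0 b) :
    |φ x| ≤ N / (2 * m) * x := by
  rcases hx.1.eq_or_lt with rfl | hx0
  · simp [h0]
  have hsub : Ioo 0 x ⊆ Ioo 0 b := Ioo_subset_Ioo_right hx.2
  have hsub' : Icc 0 x ⊆ Icc 0 b := Icc_subset_Icc_right hx.2
  obtain ⟨c, hc, hslope⟩ := exists_hasDerivAt_eq_slope (fun t => √(a t) * φ t)
    (fun t => a' t / (2 * √(a t)) * φ t + √(a t) * φ' t) hx0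
    ((ha.sqrt.mul hφ).mono hsub')
    (fun t ht => ((hda t (hsub ht)).sqrt
      (hm.trans_le (ham t (Ioo_subset_Icc_self (hsub ht)))).ne').mul (hdφ t (hsub ht)))
  have hcb := hsub hc
  have hac : 0 < a c := hm.trans_le (ham c (Ioo_subset_Icc_self hcb))
  have hsm : 0 < √m := Real.sqrt_pos.2 hm
  have hsc : √m ≤ √(a c) := Real.sqrt_le_sqrt (ham c (Ioo_subset_Icc_self hcb))
  have hsx : √m ≤ √(a x) := Real.sqrt_le_sqrt (ham x hx)
  have hval : a' c / (2 * √(a c)) * φ c + √(a c) * φ' c = r c / (2 * √(a c)) := by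
    have hs : 0 < √(a c) := hsm.trans_le hsc
    rw [← heq c hcb]
    field_simp
    rw [Real.sq_sqrt hac.le]
    ring
  have hN : 0 ≤ N := (abs_nonneg _).trans (hr c hcb)
  have hprod : √(a x) * φ x = r c / (2 * √(a c)) * x := by
    rw [← hval, hslope, h0, mul_zero, sub_zero, sub_zero, div_mul_cancel₀ _ hx0.ne']
  have h1 : √m * |φ x| ≤ N / (2 * √m) * x := by
    calc √m * |φ x| ≤ √(a x) * |φ x| := by gcongr
      _ = |r c| / (2 * √(a c)) * x := by
        rw [← abs_of_nonneg (Real.sqrt_nonneg (a x)), ← abs_mul, hprod, abs_mul, abs_div,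
          abs_of_pos hx0, abs_of_pos (by linarith : 0 < 2 * √(a c))]
      _ ≤ N / (2 * √m) * x := by
        gcongr
        exact hr c hcb
  calc |φ x| = √m * |φ x| / √m := by field_simp
    _ ≤ N / (2 * √m) * x / √m := by gcongr
    _ = N / (2 * (√m) ^ 2) * x := by field_simp
    _ = N / (2 * m) * x := by rw [Real.sq_sqrt hm.le]

variable {ℓ : ℝ} {a p q : ℝ → ℝ} {K : ℝ → ℝ → ℝ}

theorem IsGoursatSol.contDiffOn_mul (h : IsGoursatSol ℓ a p q K)
    (ha : ContDiffOn ℝ 2 a (Icc 0 ℓ)) :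
    ContDiffOn ℝ 2 (fun z : ℝ × ℝ => a z.2 * K z.1 z.2) (triangle ℓ) :=
  (ha.comp contDiff_snd.contDiffOn
    fun _ (hz : _ ∧ _ ∧ _) => ⟨hz.1, hz.2.1.trans hz.2.2⟩).mul h.1

theorem IsGoursatSol.wave_eq (hℓ : 0 < ℓ) (h : IsGoursatSol ℓ a p q K)
    (ha : ContDiffOn ℝ 2 a (Icc 0 ℓ)) {x y : ℝ} (hy : 0 < y) (hyx : y < x) (hx : x < ℓ) :
    a x * dxOn ℓ (dxOn ℓ fun z => a z.2 * K z.1 z.2) (x, y)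
        - a y * dyOn ℓ (dyOn ℓ fun z => a z.2 * K z.1 z.2) (x, y) =
      (q x - p y) * (a y * K x y) := by
  have hU := h.contDiffOn_mul ha
  have hpde := h.2.1 x y hy hyx hx
  rw [← deriv_deriv_fst hℓ hU hy.le ⟨hyx, hx⟩, ← deriv_deriv_snd hℓ hU hx.le ⟨hy, hyx⟩]
  simp only [deriv_const_mul_field]
  linear_combination a y * hpde

theorem IsGoursatSol.neumann (hℓ : 0 < ℓ) (h : IsGoursatSol ℓ a p q K)
    (ha : ContDiffOn ℝ 2 a (Icc 0 ℓ)) {x : ℝ} (hx : x ∈ Ioo 0 ℓ) :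
    dyOn ℓ (fun z => a z.2 * K z.1 z.2) (x, 0) = 0 := by
  have h0 : (0 : ℝ) ∈ Icc 0 x := left_mem_Icc.2 hx.1.le
  have hu : UniqueDiffWithinAt ℝ (Icc 0 x) 0 := uniqueDiffOn_Icc hx.1 0 h0
  have hUd := hasDerivWithinAt_dyOn ((h.contDiffOn_mul ha).differentiableOn two_ne_zero) hx.2.le h0
  have hKd : HasDerivWithinAt (fun s => K x s) _ (Icc 0 x) 0 :=
    (hasDerivWithinAt_dyOn (ContDiffOn.differentiableOn h.1 two_ne_zero) hx.2.le
      h0).differentiableWithinAt.hasDerivWithinAt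
  have had : HasDerivWithinAt a (derivWithin a (Icc 0 ℓ) 0) (Icc 0 x) 0 :=
    (ha.differentiableOn two_ne_zero 0 (left_mem_Icc.2 hℓ.le)).hasDerivWithinAt.mono
      (Icc_subset_Icc_right hx.2.le)
  have heq := hu.eq_deriv _ hUd (had.mul hKd)
  rw [heq]
  linear_combination h.2.2.1 x hx.1 hx.2

theorem IsGoursatSol.abs_diag_le (h : IsGoursatSol ℓ a p q K)
    (ha : ContDiffOn ℝ 2 a (Icc 0 ℓ)) {m b N : ℝ} (hm : 0 < m) (ham : ∀ x ∈ Icc 0 ℓ, m ≤ a x)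
    (hb : b ≤ ℓ) (hN : ∀ x ∈ Icc 0 b, |p x - q x| ≤ N) {x : ℝ} (hx : x ∈ Icc 0 b) :
    |K x x| ≤ N / (2 * m) * x := by
  have hsub : Icc 0 b ⊆ Icc 0 ℓ := Icc_subset_Icc_right hb
  have hKd : DifferentiableOn ℝ (fun z : ℝ × ℝ => K z.1 z.2) (triangle ℓ) :=
    ContDiffOn.differentiableOn h.1 two_ne_zero
  have hφ : ∀ t ∈ Icc 0 ℓ, HasDerivWithinAt (fun s => K s s)
      (derivWithin (fun s => K s s) (Icc 0 ℓ) t) (Icc 0 ℓ) t := fun t ht =>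
    (hasDerivWithinAt_diag hKd ht).differentiableWithinAt.hasDerivWithinAt
  have hnhds : ∀ t ∈ Ioo 0 b, Icc 0 ℓ ∈ nhds t := fun t ht =>
    Icc_mem_nhds ht.1 (ht.2.trans_le hb)
  refine abs_le_of_transport (r := fun t => q t - p t) hm (ha.continuousOn.mono hsub)
    (fun t ht => ham t (hsub ht))
    (fun t ht => (ha.differentiableOn two_ne_zero t
      (hsub (Ioo_subset_Icc_self ht))).hasDerivWithinAt.hasDerivAt (hnhds t ht))
    (fun t ht => (hφ t (hsub ht)).continuousWithinAt.mono hsub)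
    (fun t ht => (hφ t (hsub (Ioo_subset_Icc_self ht))).hasDerivAt (hnhds t ht))
    h.2.2.2.2 (fun t ht => h.2.2.2.1 t ht.1 (ht.2.trans_le hb))
    (fun t ht => ?_) hx
  rw [abs_sub_comm]
  exact hN t (Ioo_subset_Icc_self ht)

theorem IsGoursatSol.two_mul_diag_deriv (hℓ : 0 < ℓ) (h : IsGoursatSol ℓ a p q K)
    (ha : ContDiffOn ℝ 2 a (Icc 0 ℓ)) {x : ℝ} (hx : x ∈ Ioo 0 ℓ) :
    2 * (dxOn ℓ (fun z => a z.2 * K z.1 z.2) (x, x) +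
        dyOn ℓ (fun z => a z.2 * K z.1 z.2) (x, x)) =
      derivWithin a (Icc 0 ℓ) x * K x x + (q x - p x) := by
  have hxI := Ioo_subset_Icc_self hx
  have hUd := hasDerivWithinAt_diag ((h.contDiffOn_mul ha).differentiableOn two_ne_zero) hxI
  have hKd : HasDerivWithinAt (fun s => K s s) _ (Icc 0 ℓ) x :=
    (hasDerivWithinAt_diag (ContDiffOn.differentiableOn h.1 two_ne_zero)
      hxI).differentiableWithinAt.hasDerivWithinAt
  have had := (ha.differentiableOn two_ne_zero x hxI).hasDerivWithinAt
  have heq := (uniqueDiffOn_Icc hℓ x hxI).eq_deriv _ hUd (had.mul hKd)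
  rw [heq]
  linear_combination h.2.2.2.1 x hx.1 hx.2

theorem exists_const_goursat_bound (hℓ : 0 < ℓ) (ha : ContDiffOn ℝ 2 a (Icc 0 ℓ))
    (hapos : ∀ x ∈ Icc 0 ℓ, 0 < a x) {M : ℝ} (hM : 0 ≤ M) :
    ∃ C > (0 : ℝ), ∀ p q : ℝ → ℝ, (∀ s ∈ Icc 0 ℓ, |p s| ≤ M) → (∀ s ∈ Icc 0 ℓ, |q s| ≤ M) →
      ∀ K : ℝ → ℝ → ℝ, IsGoursatSol ℓ a p q K → ∀ b ≤ ℓ, ∀ N > (0 : ℝ),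
        (∀ s ∈ Icc 0 b, |p s - q s| ≤ N) → ∀ x y : ℝ, 0 ≤ y → y ≤ x → x ≤ b →
          |K x y| ≤ C * b * N := by
  have h0I : (0 : ℝ) ∈ Icc 0 ℓ := left_mem_Icc.2 hℓ.le
  obtain ⟨x₀, hx₀, hmin⟩ := isCompact_Icc.exists_isMinOn ⟨0, h0I⟩ ha.continuousOn
  obtain ⟨A, hA⟩ := isCompact_Icc.exists_bound_of_continuousOn ha.continuousOn
  obtain ⟨A₁, hA₁⟩ := isCompact_Icc.exists_bound_of_continuousOn
    (ha.continuousOn_derivWithin (uniqueDiffOn_Icc hℓ) (by norm_num))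
  obtain ⟨m, hm, ham⟩ : ∃ m > 0, ∀ x ∈ Icc 0 ℓ, m ≤ a x :=
    ⟨a x₀, hapos x₀ hx₀, fun x hx => hmin hx⟩
  have haA : ∀ x ∈ Icc 0 ℓ, a x ≤ A := fun x hx => (le_abs_self _).trans (hA x hx)
  have hA0 : 0 < A := (hapos 0 h0I).trans_le (haA 0 h0I)
  have hA₁0 : 0 ≤ A₁ := (norm_nonneg _).trans (hA₁ 0 h0I)
  have hD : 0 ≤ A / (2 * m) := by positivity
  let C := A / (2 * m) + 1 / 2 + A * (((1 + A₁ * ℓ / (2 * m)) / 2) ^ 2 / m +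
    (A / (2 * m) * ℓ) ^ 2) * Real.exp (((2 * M / m ^ 2 + 1) * (1 + A) + A₁ / m) * ℓ) / 2
  have hC : 0 < C := by positivity
  refine ⟨C / m, div_pos hC hm, fun p q hp hq K h b hb N hN hpq x y hy hyx hx => ?_⟩
  have hx0 : 0 ≤ x := hy.trans hyx
  have hdiag := fun t ht => h.abs_diag_le ha hm ham hb hpq (x := t) ht
  have hU := abs_le_of_wave (U := fun z => a z.2 * K z.1 z.2) (M := 2 * M)
    (B := (1 + A₁ * ℓ / (2 * m)) / 2) hℓ ha hm ham haA hA₁ (by positivity)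
    (h.contDiffOn_mul ha) hb hN hD
    (fun t s hs hst ht => by
      have htl : t < ℓ := ht.trans_le hb
      rw [h.wave_eq hℓ ha hs hst htl, abs_mul]
      gcongr
      have h1 := hq t ⟨(hs.trans hst).le, htl.le⟩
      have h2 := hp s ⟨hs.le, (hst.trans htl).le⟩
      exact (abs_sub _ _).trans (by linarith))
    (fun t ht => h.neumann hℓ ha ⟨ht.1, ht.2.trans_le hb⟩)
    (fun t ht => by
      have htl : t ∈ Icc 0 ℓ := ⟨ht.1, ht.2.trans hb⟩
      dsimp only
      rw [abs_mul, abs_of_pos (hapos t htl)]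
      calc a t * |K t t| ≤ A * (N / (2 * m) * t) :=
            mul_le_mul (haA t htl) (hdiag t ht) (abs_nonneg _) hA0.le
        _ = A / (2 * m) * t * N := by ring)
    (fun t ht => by
      have htl : t ∈ Ioo 0 ℓ := ⟨ht.1, ht.2.trans_le hb⟩
      have h1 := h.two_mul_diag_deriv hℓ ha htl
      have h2 : |derivWithin a (Icc 0 ℓ) t * K t t| ≤ A₁ * (N / (2 * m) * ℓ) := by
        rw [abs_mul]
        exact mul_le_mul (hA₁ t (Ioo_subset_Icc_self htl))
          ((hdiag t (Ioo_subset_Icc_self ht)).trans (by gcongr; exact htl.2.le))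
          (abs_nonneg _) hA₁0
      have h3 : |q t - p t| ≤ N := by
        rw [abs_sub_comm]; exact hpq t (Ioo_subset_Icc_self ht)
      have h4 := (abs_add_le _ _).trans (add_le_add h2 h3)
      rw [← h1, abs_mul, abs_two] at h4
      calc _ ≤ (A₁ * (N / (2 * m) * ℓ) + N) / 2 := by linarith
        _ = _ := by ring)
    hy hyx hx
  have hyI : y ∈ Icc 0 ℓ := ⟨hy, hyx.trans (hx.trans hb)⟩
  have hU' : a y * |K x y| ≤ C * x * N := by
    rw [← abs_of_pos (hapos y hyI), ← abs_mul]; exact hU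
  have hle : m * |K x y| ≤ C * b * N :=
    (mul_le_mul_of_nonneg_right (ham y hyI) (abs_nonneg _)).trans (hU'.trans (by gcongr))
  calc |K x y| = m * |K x y| / m := by field_simp
    _ ≤ C * b * N / m := by gcongr
    _ = C / m * b * N := by ring

end Goursat

/-- A priori estimate (2.15) for the Goursat problem: on every subtriangle
`closure Ω_x`, the kernel `K` is bounded by `C·x·‖p − q‖_{C[0,x]}`, with `C`
depending only on `ℓ`, `a` and the bound `M` on `‖p‖`, `‖q‖`. -/
theorem stmt_9
    (ℓ : ℝ) (hℓ : 0 < ℓ)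
    (a : ℝ → ℝ) (ha : ContDiffOn ℝ 2 a (Icc 0 ℓ))
    (hapos : ∀ x ∈ Icc (0:ℝ) ℓ, 0 < a x)
    (M : ℝ) (hM : 0 < M) :
    ∃ C > (0:ℝ), ∀ p q : ℝ → ℝ,
      ContDiffOn ℝ 1 p (Icc 0 ℓ) → ContDiffOn ℝ 1 q (Icc 0 ℓ) →
      (∀ s ∈ Icc (0:ℝ) ℓ, |p s| ≤ M) → (∀ s ∈ Icc (0:ℝ) ℓ, |q s| ≤ M) →
      ∀ K : ℝ → ℝ → ℝ, IsGoursatSol ℓ a p q K →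
        ∀ x ∈ Ioc (0:ℝ) ℓ, ∀ x' y : ℝ, 0 ≤ y → y ≤ x' → x' ≤ x →
          |K x' y| ≤ C * x * sSup ((fun s => |p s - q s|) '' Icc 0 x) := by
  obtain ⟨C, hC, hbound⟩ := exists_const_goursat_bound hℓ ha hapos hM.le
  refine ⟨C, hC, fun p q _ _ hp hq K h x hx x' y hy hyx' hx' => ?_⟩
  set S := sSup ((fun s => |p s - q s|) '' Icc 0 x) with hS
  have hbdd : BddAbove ((fun s => |p s - q s|) '' Icc 0 x) := by
    refine ⟨M + M, forall_mem_image.2 fun s hs => ?_⟩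
    have hsl : s ∈ Icc 0 ℓ := ⟨hs.1, hs.2.trans hx.2⟩
    exact (abs_sub _ _).trans (add_le_add (hp s hsl) (hq s hsl))
  have hle : ∀ s ∈ Icc 0 x, |p s - q s| ≤ S := fun s hs =>
    le_csSup hbdd (mem_image_of_mem (fun s => |p s - q s|) hs)
  have hS0 : 0 ≤ S := (abs_nonneg _).trans (hle 0 (left_mem_Icc.2 hx.1.le))
  have hCx : 0 < C * x := mul_pos hC hx.1
  refine le_of_forall_pos_le_add fun ε hε => ?_
  have hε' : 0 < ε / (C * x) := div_pos hε hCx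
  have hK := hbound p q hp hq K h x hx.2 (S + ε / (C * x)) (by linarith)
    (fun s hs => (hle s hs).trans (by linarith)) x' y hy hyx' hx'
  rwa [mul_add, mul_div_cancel₀ _ hCx.ne'] at hK
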